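/- Fix δ<1 and let Π^δ = {π stationary : ∀s∈S ∃a∈A, π(a|s) ≥ δ} be the set of δ-deterministic policies. Then any pair of reward functions R₁, R₂ that are unhackable on Π^δ and both non-trivial on Π^δ are equivalent on Π^δ. -/

import Mathlib

open scoped BigOperators

/-- A rewardless MDP with finite state and action spaces: transition kernel `T`,
initial distribution `I`, and discount factor `γ ∈ (0,1)`. -/
structure MDPnr (S A : Type) [Fintype S] [Fintype A] where
  T : S → A → S → ℝ
  T_nonneg : ∀ s a s', 0 ≤ T s a s'
  T_sum : ∀ s a, ∑ s', T s a s' = 1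
  I : S → ℝ
  I_nonneg : ∀ s, 0 ≤ I s
  I_sum : ∑ s, I s = 1
  γ : ℝ
  γ_pos : 0 < γ
  γ_lt_one : γ < 1

variable {S A : Type} [Fintype S] [Fintype A]

/-- A stationary policy: a distribution over actions in each state. -/
def IsPolicy (π : S → A → ℝ) : Prop :=
  (∀ s a, 0 ≤ π s a) ∧ ∀ s, ∑ a, π s a = 1

/-- The set of all stationary policies. -/
def allPolicies (S A : Type) [Fintype S] [Fintype A] : Set (S → A → ℝ) :=
  {π | IsPolicy π}

/-- The distribution over states at time `t` induced by policy `π`. -/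
def stateDist (M : MDPnr S A) (π : S → A → ℝ) : ℕ → S → ℝ
  | 0 => M.I
  | t + 1 => fun s' => ∑ s, ∑ a, stateDist M π t s * π s a * M.T s a s'

/-- Discounted state-action visit counts `F(π)(s,a) = ∑ₜ γᵗ P(Sₜ = s, Aₜ = a)`. -/
noncomputable def visit (M : MDPnr S A) (π : S → A → ℝ) : S → A → ℝ :=
  fun s a => ∑' t : ℕ, M.γ ^ t * stateDist M π t s * π s a

/-- The visit counts viewed as a vector in `ℝ^{S×A}`. -/
noncomputable def Fvec (M : MDPnr S A) (π : S → A → ℝ) : S × A → ℝ :=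
  fun p => visit M π p.1 p.2

/-- The value `J_R(π) = ∑_{s,a} R(s,a) F(π)(s,a)` of a policy `π` under reward `R`. -/
noncomputable def Jval (M : MDPnr S A) (R : S → A → ℝ) (π : S → A → ℝ) : ℝ :=
  ∑ s, ∑ a, R s a * visit M π s a

/-- `R₁, R₂` are unhackable on policy set `P` if no pair of policies is ordered
oppositely by the two reward functions. -/
def Unhackable (M : MDPnr S A) (P : Set (S → A → ℝ)) (R₁ R₂ : S → A → ℝ) : Prop :=
  ¬ ∃ π ∈ P, ∃ π' ∈ P, Jval M R₁ π < Jval M R₁ π' ∧ Jval M R₂ π > Jval M R₂ π'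

/-- `R₁, R₂` are equivalent on `P` if they induce the same preference ordering. -/
def EquivalentOn (M : MDPnr S A) (P : Set (S → A → ℝ)) (R₁ R₂ : S → A → ℝ) : Prop :=
  ∀ π ∈ P, ∀ π' ∈ P, (Jval M R₁ π ≤ Jval M R₁ π' ↔ Jval M R₂ π ≤ Jval M R₂ π')

/-- `R` is trivial on `P` if its value function is constant on `P`. -/
def TrivialOn (M : MDPnr S A) (P : Set (S → A → ℝ)) (R : S → A → ℝ) : Prop :=
  ∀ π ∈ P, ∀ π' ∈ P, Jval M R π = Jval M R π'

/-- The embedding `G(π)(s,a) = π(a|s)` of policies into `ℝ^{S×A}`. -/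
def Gmap (π : S → A → ℝ) : S × A → ℝ := fun p => π p.1 p.2

/-- A set of stationary policies is open if its image under `G` is open in the
smallest affine subspace of `ℝ^{S×A}` containing the `G`-image of all policies. -/
def OpenPolicySet (Pd : Set (S → A → ℝ)) : Prop :=
  Pd ⊆ allPolicies S A ∧
  IsOpen {x : (affineSpan ℝ (Gmap '' allPolicies S A) : Set (S × A → ℝ)) |
    (x : S × A → ℝ) ∈ Gmap '' Pd}

/-- Every state is reachable (with positive probability) under some policy. -/
def AllReachable (M : MDPnr S A) : Prop :=
  ∀ s : S, ∃ π : S → A → ℝ, IsPolicy π ∧ ∃ t : ℕ, 0 < stateDist M π t s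

/-- `R₂` is a simplification of `R₁` relative to `P`. -/
def Simplification (M : MDPnr S A) (P : Set (S → A → ℝ)) (R₁ R₂ : S → A → ℝ) : Prop :=
  (∀ π ∈ P, ∀ π' ∈ P,
    (Jval M R₁ π < Jval M R₁ π' → Jval M R₂ π ≤ Jval M R₂ π') ∧
    (Jval M R₁ π = Jval M R₁ π' → Jval M R₂ π = Jval M R₂ π')) ∧
  ∃ π ∈ P, ∃ π' ∈ P, Jval M R₂ π = Jval M R₂ π' ∧ Jval M R₁ π ≠ Jval M R₁ π'

/-- The set of δ-deterministic stationary policies: in each state some action has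
probability at least δ. -/
def DetSet (S A : Type) [Fintype S] [Fintype A] (δ : ℝ) : Set (S → A → ℝ) :=
  {π | IsPolicy π ∧ ∀ s : S, ∃ a : A, δ ≤ π s a}

theorem stateDist_nonneg (M : MDPnr S A) {π : S → A → ℝ} (hπ : IsPolicy π) (t : ℕ) (s : S) :
    0 ≤ stateDist M π t s := by
  induction t generalizing s with
  | zero => exact M.I_nonneg s
  | succ t ih =>
    exact Finset.sum_nonneg fun s' _ => Finset.sum_nonneg fun a _ =>
      mul_nonneg (mul_nonneg (ih s') (hπ.1 s' a)) (M.T_nonneg s' a s)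

theorem sum_policy_flow (M : MDPnr S A) {π : S → A → ℝ} (hπ : IsPolicy π) (d : S → ℝ) :
    ∑ s', ∑ s, ∑ a, d s * π s a * M.T s a s' = ∑ s, d s := by
  rw [Finset.sum_comm]
  refine Finset.sum_congr rfl fun s _ => ?_
  rw [Finset.sum_comm]
  simp_rw [← Finset.mul_sum, M.T_sum, mul_one]
  rw [← Finset.mul_sum, hπ.2 s, mul_one]

theorem sum_stateDist (M : MDPnr S A) {π : S → A → ℝ} (hπ : IsPolicy π) (t : ℕ) :
    ∑ s, stateDist M π t s = 1 := by
  induction t with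
  | zero => exact M.I_sum
  | succ t ih =>
    rw [← ih]
    exact sum_policy_flow M hπ (stateDist M π t)

theorem summable_discounted_stateDist (M : MDPnr S A) {π : S → A → ℝ} (hπ : IsPolicy π) (s : S) :
    Summable fun t : ℕ => M.γ ^ t * stateDist M π t s := by
  refine Summable.of_nonneg_of_le
    (fun t => mul_nonneg (pow_nonneg M.γ_pos.le t) (stateDist_nonneg M hπ t s)) (fun t => ?_)
    (summable_geometric_of_lt_one M.γ_pos.le M.γ_lt_one)
  refine mul_le_of_le_one_right (pow_nonneg M.γ_pos.le t) ?_
  rw [← sum_stateDist M hπ t]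
  exact Finset.single_le_sum (fun s' _ => stateDist_nonneg M hπ t s') (Finset.mem_univ s)

/-- The discounted state visit counts of a policy. -/
noncomputable def stateVisit (M : MDPnr S A) (π : S → A → ℝ) (s : S) : ℝ :=
  ∑' t : ℕ, M.γ ^ t * stateDist M π t s

theorem visit_eq_stateVisit_mul (M : MDPnr S A) (π : S → A → ℝ) (s : S) (a : A) :
    visit M π s a = stateVisit M π s * π s a :=
  tsum_mul_right

theorem sum_visit (M : MDPnr S A) {π : S → A → ℝ} (hπ : IsPolicy π) (s : S) :
    ∑ a, visit M π s a = stateVisit M π s := by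
  simp_rw [visit_eq_stateVisit_mul, ← Finset.mul_sum, hπ.2 s, mul_one]

theorem stateVisit_flow (M : MDPnr S A) {π : S → A → ℝ} (hπ : IsPolicy π) (s' : S) :
    stateVisit M π s' =
      M.I s' + M.γ * ∑ s, ∑ a, stateVisit M π s * π s a * M.T s a s' := by
  rw [stateVisit, (summable_discounted_stateDist M hπ s').tsum_eq_zero_add]
  congr 1
  · simp [stateDist]
  · have h : HasSum (fun t : ℕ => M.γ * ∑ s, ∑ a,
        M.γ ^ t * stateDist M π t s * π s a * M.T s a s')
        (M.γ * ∑ s, ∑ a, stateVisit M π s * π s a * M.T s a s') :=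
      (hasSum_sum fun s _ => hasSum_sum fun a _ =>
        ((summable_discounted_stateDist M hπ s).hasSum.mul_right _).mul_right _).mul_left _
    rw [← h.tsum_eq]
    refine tsum_congr fun t => ?_
    simp only [stateDist, Finset.mul_sum]
    refine Finset.sum_congr rfl fun s _ => Finset.sum_congr rfl fun a _ => ?_
    ring

/-- The Bellman flow equation has only one solution. -/
theorem eq_stateVisit_of_flow (M : MDPnr S A) {π : S → A → ℝ} (hπ : IsPolicy π) {d : S → ℝ}
    (hd : ∀ s', d s' = M.I s' + M.γ * ∑ s, ∑ a, d s * π s a * M.T s a s') :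
    d = stateVisit M π := by
  set e : S → ℝ := fun s => |d s - stateVisit M π s| with he
  have hle : ∀ s', e s' ≤ M.γ * ∑ s, ∑ a, e s * π s a * M.T s a s' := by
    intro s'
    have h : d s' - stateVisit M π s' =
        M.γ * ∑ s, ∑ a, (d s - stateVisit M π s) * π s a * M.T s a s' := by
      conv_lhs => rw [hd s', stateVisit_flow M hπ s']
      simp only [sub_mul, Finset.sum_sub_distrib]
      ring
    simp only [he]
    rw [h, abs_mul, abs_of_pos M.γ_pos]
    refine mul_le_mul_of_nonneg_left ?_ M.γ_pos.le
    refine (Finset.abs_sum_le_sum_abs _ _).trans (Finset.sum_le_sum fun s _ => ?_)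
    refine (Finset.abs_sum_le_sum_abs _ _).trans (Finset.sum_le_sum fun a _ => ?_)
    rw [abs_mul, abs_mul, abs_of_nonneg (hπ.1 s a), abs_of_nonneg (M.T_nonneg s a s')]
  have hsum : ∑ s, e s ≤ M.γ * ∑ s, e s := by
    calc ∑ s, e s ≤ ∑ s', M.γ * ∑ s, ∑ a, e s * π s a * M.T s a s' :=
          Finset.sum_le_sum fun s' _ => hle s'
      _ = M.γ * ∑ s, e s := by rw [← Finset.mul_sum, sum_policy_flow M hπ]
  have hnonneg : ∀ s ∈ Finset.univ, 0 ≤ e s := fun s _ => abs_nonneg _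
  have hzero : ∑ s, e s = 0 := by
    have := Finset.sum_nonneg hnonneg
    nlinarith [M.γ_lt_one]
  funext s
  exact sub_eq_zero.mp
    (abs_eq_zero.mp ((Finset.sum_eq_zero_iff_of_nonneg hnonneg).mp hzero s (Finset.mem_univ s)))

theorem visit_normalize (M : MDPnr S A) {μ : S → A → ℝ} (hμ : ∀ s, ∑ a, μ s a ≠ 0)
    (hπ : IsPolicy fun s a => μ s a / ∑ b, μ s b)
    (hflow : ∀ s', ∑ a, μ s' a = M.I s' + M.γ * ∑ s, ∑ a, μ s a * M.T s a s') :
    visit M (fun s a => μ s a / ∑ b, μ s b) = μ := by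
  have hd : (fun s => ∑ b, μ s b) = stateVisit M fun s a => μ s a / ∑ b, μ s b := by
    refine eq_stateVisit_of_flow M hπ fun s' => ?_
    simp_rw [mul_div_cancel₀ _ (hμ _)]
    exact hflow s'
  funext s a
  rw [visit_eq_stateVisit_mul, ← hd]
  exact mul_div_cancel₀ _ (hμ s)

theorem stateDist_pos_of_full_support (M : MDPnr S A) {π₀ π : S → A → ℝ} (hπ₀ : IsPolicy π₀)
    (hpos : ∀ s a, 0 < π₀ s a) (hπ : IsPolicy π) {t : ℕ} {s : S}
    (h : 0 < stateDist M π t s) : 0 < stateDist M π₀ t s := by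
  induction t generalizing s with
  | zero => exact h
  | succ t ih =>
    obtain ⟨s', -, hs'⟩ := Finset.exists_lt_of_sum_lt
      (f := fun _ : S => (0 : ℝ)) (by simpa [stateDist] using h)
    obtain ⟨a, -, ha⟩ := Finset.exists_lt_of_sum_lt
      (f := fun _ : A => (0 : ℝ)) (by simpa using hs')
    have hd : 0 < stateDist M π t s' := by
      refine (stateDist_nonneg M hπ t s').lt_of_ne' fun h0 => ?_
      simp [h0] at ha
    have hT : 0 < M.T s' a s := by
      refine (M.T_nonneg s' a s).lt_of_ne' fun h0 => ?_
      simp [h0] at ha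
    have hterm : ∀ s' a, 0 ≤ stateDist M π₀ t s' * π₀ s' a * M.T s' a s := fun s' a =>
      mul_nonneg (mul_nonneg (stateDist_nonneg M hπ₀ t s') (hπ₀.1 s' a)) (M.T_nonneg s' a s)
    exact Finset.sum_pos' (fun s' _ => Finset.sum_nonneg fun a _ => hterm s' a)
      ⟨s', Finset.mem_univ _, Finset.sum_pos' (fun a _ => hterm s' a)
        ⟨a, Finset.mem_univ _, mul_pos (mul_pos (ih hd) (hpos s' a)) hT⟩⟩

theorem stateVisit_pos_of_full_support (M : MDPnr S A) (hreach : AllReachable M)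
    {π₀ : S → A → ℝ} (hπ₀ : IsPolicy π₀) (hpos : ∀ s a, 0 < π₀ s a) (s : S) :
    0 < stateVisit M π₀ s := by
  obtain ⟨π, hπ, t, ht⟩ := hreach s
  exact (summable_discounted_stateDist M hπ₀ s).tsum_pos
    (fun t => mul_nonneg (pow_nonneg M.γ_pos.le t) (stateDist_nonneg M hπ₀ t s)) t
    (mul_pos (pow_pos M.γ_pos t) (stateDist_pos_of_full_support M hπ₀ hpos hπ ht))

/-- Some policy with full support satisfies the `δ`-determinism bound strictly. -/
theorem exists_full_support_strict_det {S A : Type} [Fintype A] [Nonempty A] {δ : ℝ} (hδ : δ < 1) :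
    ∃ π : S → A → ℝ, IsPolicy π ∧ (∀ s a, 0 < π s a) ∧ ∃ a, ∀ s, δ < π s a := by
  classical
  obtain ⟨a₀⟩ := ‹Nonempty A›
  have : Nonempty A := ⟨a₀⟩
  have hcard : (0 : ℝ) < Fintype.card A := by exact_mod_cast Fintype.card_pos
  obtain ⟨p, hp, hp1⟩ := exists_between (max_lt hδ zero_lt_one)
  obtain ⟨hδp, hp0⟩ := max_lt_iff.mp hp
  have hu : 0 < (1 - p) / Fintype.card A := div_pos (by linarith) hcard
  have hpos : ∀ a, 0 < (if a = a₀ then p else 0) + (1 - p) / Fintype.card A := fun a => by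
    split_ifs <;> linarith
  refine ⟨fun _ a => (if a = a₀ then p else 0) + (1 - p) / Fintype.card A,
    ⟨fun _ a => (hpos a).le, fun _ => ?_⟩, fun _ a => hpos a, a₀, fun _ => ?_⟩
  · rw [Finset.sum_add_distrib]
    simp only [Finset.sum_ite_eq', Finset.mem_univ, if_true, Finset.sum_const, Finset.card_univ,
      nsmul_eq_mul]
    field_simp
    ring
  · simp only [if_true]
    linarith

/-- `v` is tangent to the affine space of solutions of the Bellman flow equation. -/
def IsFlowDirection (M : MDPnr S A) (v : S → A → ℝ) : Prop :=
  ∀ s', ∑ a, v s' a = M.γ * ∑ s, ∑ a, v s a * M.T s a s'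

theorem visit_flow (M : MDPnr S A) {π : S → A → ℝ} (hπ : IsPolicy π) (s' : S) :
    ∑ a, visit M π s' a = M.I s' + M.γ * ∑ s, ∑ a, visit M π s a * M.T s a s' := by
  simp_rw [sum_visit M hπ, visit_eq_stateVisit_mul]
  exact stateVisit_flow M hπ s'

theorem IsFlowDirection.add_smul {M : MDPnr S A} {v w : S → A → ℝ} (hv : IsFlowDirection M v)
    (hw : IsFlowDirection M w) (c : ℝ) : IsFlowDirection M (v + c • w) := fun s' => by
  simp only [Pi.add_apply, Pi.smul_apply, smul_eq_mul, add_mul, Finset.sum_add_distrib,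
    mul_assoc, ← Finset.mul_sum, hv s', hw s']
  ring

theorem IsFlowDirection.neg {M : MDPnr S A} {v : S → A → ℝ} (hv : IsFlowDirection M v) :
    IsFlowDirection M (-v) := fun s' => by
  simp only [Pi.neg_apply, neg_mul, Finset.sum_neg_distrib, mul_neg, hv s']

theorem isFlowDirection_visit_sub (M : MDPnr S A) {π π' : S → A → ℝ} (hπ : IsPolicy π)
    (hπ' : IsPolicy π') : IsFlowDirection M (visit M π - visit M π') := fun s' => by
  simp only [Pi.sub_apply, sub_mul, Finset.sum_sub_distrib, visit_flow M hπ s',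
    visit_flow M hπ' s']
  ring

/-- The linear functional on `S → A → ℝ` given by pairing with `R`. -/
def rewardPairing (R : S → A → ℝ) : (S → A → ℝ) →ₗ[ℝ] ℝ where
  toFun v := ∑ s, ∑ a, R s a * v s a
  map_add' v w := by simp [mul_add, Finset.sum_add_distrib]
  map_smul' c v := by simp [Finset.mul_sum, mul_left_comm]

theorem rewardPairing_visit (M : MDPnr S A) (R π : S → A → ℝ) :
    rewardPairing R (visit M π) = Jval M R π := rfl

/-- Around a strictly `δ`-deterministic policy of full support, the visit counts can be moved
in every flow direction within the `δ`-deterministic policies. -/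
theorem exists_det_visit_eq_add_smul (M : MDPnr S A) (hreach : AllReachable M) {δ : ℝ}
    {π₀ : S → A → ℝ} (hπ₀ : IsPolicy π₀) (hpos : ∀ s a, 0 < π₀ s a) {a₀ : A}
    (hdet : ∀ s, δ < π₀ s a₀) {v : S → A → ℝ} (hv : IsFlowDirection M v) :
    ∃ ε : ℝ, 0 < ε ∧ ∃ π ∈ DetSet S A δ, visit M π = visit M π₀ + ε • v := by
  set μ : ℝ → S → A → ℝ := fun ε => visit M π₀ + ε • v with hμ
  have hd := stateVisit_pos_of_full_support M hreach hπ₀ hpos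
  have hsum0 : ∀ s, ∑ a, μ 0 s a = stateVisit M π₀ s := fun s => by
    simp [hμ, sum_visit M hπ₀]
  have hcont : ∀ s a, Continuous fun ε => μ ε s a := fun s a => by
    simp only [hμ, Pi.add_apply, Pi.smul_apply, smul_eq_mul]
    fun_prop
  have hcontSum : ∀ s, Continuous fun ε => ∑ a, μ ε s a := fun s =>
    continuous_finsetSum _ fun a _ => hcont s a
  have hcontDiv : ∀ s a, ContinuousAt (fun ε => μ ε s a / ∑ b, μ ε s b) 0 := fun s a =>
    (hcont s a).continuousAt.div (hcontSum s).continuousAt (by rw [hsum0]; exact (hd s).ne')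
  have hdiv0 : ∀ s a, μ 0 s a / ∑ b, μ 0 s b = π₀ s a := fun s a => by
    rw [hsum0]
    simp [hμ, visit_eq_stateVisit_mul, (hd s).ne']
  have hev : ∀ᶠ ε in nhds (0 : ℝ), (∀ s, 0 < ∑ a, μ ε s a) ∧
      (∀ s a, 0 < μ ε s a / ∑ b, μ ε s b) ∧ ∀ s, δ < μ ε s a₀ / ∑ b, μ ε s b := by
    refine (Filter.eventually_all.2 fun s => ?_).and
      ((Filter.eventually_all.2 fun s => Filter.eventually_all.2 fun a => ?_).and
        (Filter.eventually_all.2 fun s => ?_))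
    · exact (hcontSum s).continuousAt.eventually_const_lt ((hd s).trans_eq (hsum0 s).symm)
    · exact (hcontDiv s a).eventually_const_lt ((hpos s a).trans_eq (hdiv0 s a).symm)
    · exact (hcontDiv s a₀).eventually_const_lt ((hdet s).trans_eq (hdiv0 s a₀).symm)
  obtain ⟨ε, ⟨hεsum, hεpos, hεdet⟩, hε⟩ :=
    ((hev.filter_mono nhdsWithin_le_nhds).and
      (self_mem_nhdsWithin : Set.Ioi (0 : ℝ) ∈ nhdsWithin 0 (Set.Ioi 0))).exists
  have hπ : IsPolicy fun s a => μ ε s a / ∑ b, μ ε s b := by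
    refine ⟨fun s a => (hεpos s a).le, fun s => ?_⟩
    rw [← Finset.sum_div, div_self (hεsum s).ne']
  refine ⟨ε, hε, _, ⟨hπ, fun s => ⟨a₀, (hεdet s).le⟩⟩,
    visit_normalize M (fun s => (hεsum s).ne') hπ fun s' => ?_⟩
  simp only [hμ, Pi.add_apply, Pi.smul_apply, smul_eq_mul, add_mul, Finset.sum_add_distrib,
    mul_assoc, ← Finset.mul_sum, visit_flow M hπ₀ s', hv s']
  ring

/-- An unhackable pair of rewards has no flow direction along which they disagree. -/
theorem Unhackable.rewardPairing_nonneg {M : MDPnr S A} [Nonempty A] (hreach : AllReachable M)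
    {δ : ℝ} (hδ : δ < 1) {R₁ R₂ : S → A → ℝ} (hunh : Unhackable M (DetSet S A δ) R₁ R₂)
    {v : S → A → ℝ} (hv : IsFlowDirection M v) (h : 0 < rewardPairing R₁ v) :
    0 ≤ rewardPairing R₂ v := by
  by_contra! hneg
  obtain ⟨π₀, hπ₀, hpos, a₀, hdet⟩ := exists_full_support_strict_det (S := S) (A := A) hδ
  obtain ⟨ε, hε, π, hπ, hvisit⟩ := exists_det_visit_eq_add_smul M hreach hπ₀ hpos hdet hv
  refine hunh ⟨π₀, ⟨hπ₀, fun s => ⟨a₀, (hdet s).le⟩⟩, π, hπ, ?_, ?_⟩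
  · rw [← rewardPairing_visit M R₁ π, hvisit, map_add, map_smul, rewardPairing_visit, smul_eq_mul]
    linarith [mul_pos hε h]
  · rw [← rewardPairing_visit M R₂ π, hvisit, map_add, map_smul, rewardPairing_visit, smul_eq_mul]
    linarith [mul_neg_of_pos_of_neg hε hneg]

theorem Unhackable.symm {M : MDPnr S A} {P : Set (S → A → ℝ)} {R₁ R₂ : S → A → ℝ}
    (h : Unhackable M P R₁ R₂) : Unhackable M P R₂ R₁ :=
  fun ⟨π, hπ, π', hπ', h₂, h₁⟩ => h ⟨π', hπ', π, hπ, h₁, h₂⟩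

theorem exists_flowDirection_neg {M : MDPnr S A} {δ : ℝ} {R : S → A → ℝ}
    (h : ¬ TrivialOn M (DetSet S A δ) R) :
    ∃ u, IsFlowDirection M u ∧ rewardPairing R u < 0 := by
  simp only [TrivialOn, not_forall] at h
  obtain ⟨π, hπ, π', hπ', hne⟩ := h
  rcases lt_or_gt_of_ne hne with hlt | hlt
  · refine ⟨_, isFlowDirection_visit_sub M hπ.1 hπ'.1, ?_⟩
    rw [map_sub, rewardPairing_visit, rewardPairing_visit]
    linarith
  · refine ⟨_, isFlowDirection_visit_sub M hπ'.1 hπ.1, ?_⟩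
    rw [map_sub, rewardPairing_visit, rewardPairing_visit]
    linarith

theorem Unhackable.rewardPairing_pos {M : MDPnr S A} [Nonempty A] (hreach : AllReachable M)
    {δ : ℝ} (hδ : δ < 1) {R₁ R₂ : S → A → ℝ} (hunh : Unhackable M (DetSet S A δ) R₁ R₂)
    (h₂ : ¬ TrivialOn M (DetSet S A δ) R₂)
    {v : S → A → ℝ} (hv : IsFlowDirection M v) (h : 0 < rewardPairing R₁ v) :
    0 < rewardPairing R₂ v := by
  refine (hunh.rewardPairing_nonneg hreach hδ hv h).lt_of_ne' fun h0 => ?_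
  obtain ⟨u, hu, hneg⟩ := exists_flowDirection_neg h₂
  obtain ⟨c, hc, hcpos⟩ : ∃ c : ℝ, 0 < c ∧ 0 < rewardPairing R₁ v + c * rewardPairing R₁ u := by
    have hcont : Continuous fun c : ℝ => rewardPairing R₁ v + c * rewardPairing R₁ u := by fun_prop
    have hev := (hcont.tendsto 0).eventually_const_lt (u := 0) (by simpa using h)
    obtain ⟨c, hc, hc0⟩ := ((hev.filter_mono nhdsWithin_le_nhds).and
      (self_mem_nhdsWithin : Set.Ioi (0 : ℝ) ∈ nhdsWithin 0 (Set.Ioi 0))).exists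
    exact ⟨c, hc0, hc⟩
  have hnonneg := hunh.rewardPairing_nonneg hreach hδ (hv.add_smul hu c)
    (by rwa [map_add, map_smul, smul_eq_mul])
  rw [map_add, map_smul, smul_eq_mul, h0, zero_add] at hnonneg
  linarith [mul_neg_of_pos_of_neg hc hneg]

/-- On the set of all δ-deterministic policies (δ < 1), any pair of
unhackable, non-trivial reward functions are equivalent. -/
theorem unhackable_nontrivial_equivalent_on_det
    (M : MDPnr S A) (hA : 1 < Fintype.card A) (hreach : AllReachable M)
    (δ : ℝ) (hδ : δ < 1)
    (R₁ R₂ : S → A → ℝ)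
    (hunh : Unhackable M (DetSet S A δ) R₁ R₂)
    (h1 : ¬ TrivialOn M (DetSet S A δ) R₁)
    (h2 : ¬ TrivialOn M (DetSet S A δ) R₂) :
    EquivalentOn M (DetSet S A δ) R₁ R₂ := by
  have : Nonempty A := Fintype.card_pos_iff.mp (zero_lt_one.trans hA)
  intro π hπ π' hπ'
  have hv := isFlowDirection_visit_sub M hπ.1 hπ'.1
  have hiff : 0 < rewardPairing R₁ (visit M π - visit M π') ↔
      0 < rewardPairing R₂ (visit M π - visit M π') :=
    ⟨hunh.rewardPairing_pos hreach hδ h2 hv, hunh.symm.rewardPairing_pos hreach hδ h1 hv⟩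
  simp only [map_sub, rewardPairing_visit, sub_pos] at hiff
  exact not_lt.symm.trans (hiff.not.trans not_lt)
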